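/- Let 𝒫₀ be a nonempty convex set of Borel probability measures on ℝ that is compact in the topology of weak convergence. For bounded Lipschitz φ : ℝ² → ℝ define Ê[φ] := sup_{P∈𝒫₀} ∫_ℝ ( sup_{Q∈𝒫₀} ∫_ℝ φ(x,y) dQ(y) ) dP(x). Then a Borel probability measure ν on ℝ² satisfies ∫ φ dν ≤ Ê[φ] for every bounded Lipschitz φ : ℝ² → ℝ if and only if there exist μ₁ ∈ 𝒫₀ and a Markov kernel κ from ℝ to ℝ with κ(x, ·) ∈ 𝒫₀ for every x ∈ ℝ such that ν is the composition of μ₁ and κ, i.e., ν(A) = ∫_ℝ κ(x, {y : (x,y) ∈ A}) dμ₁(x) for every Borel set A ⊆ ℝ². -/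

import Mathlib

open MeasureTheory ProbabilityTheory Filter
open scoped ENNReal NNReal

noncomputable section

open Topology BoundedContinuousFunction

/-- The bounded continuous function `thickenedIndicator (1 / (n + 1)) F`, as a real-valued one. -/
def thickenedIndicatorReal (F : Set ℝ) (n : ℕ) : ℝ →ᵇ ℝ :=
  BoundedContinuousFunction.ofNormedAddCommGroup
    (fun x ↦ (thickenedIndicator (Nat.one_div_pos_of_nat (α := ℝ) (n := n)) F x : ℝ))
    (NNReal.continuous_coe.comp (thickenedIndicator _ F).continuous) 1
    (fun x ↦ by
      rw [Real.norm_of_nonneg (NNReal.coe_nonneg _)]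
      exact_mod_cast thickenedIndicator_le_one _ F x)

lemma lipschitz_thickenedIndicatorReal (F : Set ℝ) (n : ℕ) :
    ∃ C : ℝ≥0, LipschitzWith C (thickenedIndicatorReal F n) :=
  ⟨_, (LipschitzWith.subtype_val _).comp
    (lipschitzWith_thickenedIndicator (Nat.one_div_pos_of_nat (α := ℝ) (n := n)) F)⟩

lemma thickenedIndicatorReal_nonneg (F : Set ℝ) (n : ℕ) (x : ℝ) :
    0 ≤ thickenedIndicatorReal F n x := NNReal.coe_nonneg _

lemma thickenedIndicatorReal_le_one (F : Set ℝ) (n : ℕ) (x : ℝ) :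
    thickenedIndicatorReal F n x ≤ 1 :=
  NNReal.coe_le_coe.2 (thickenedIndicator_le_one (Nat.one_div_pos_of_nat (α := ℝ) (n := n)) F x)

lemma tendsto_thickenedIndicatorReal {F : Set ℝ} (hF : IsClosed F) (x : ℝ) :
    Tendsto (fun n ↦ thickenedIndicatorReal F n x) atTop (𝓝 (F.indicator (fun _ ↦ (1 : ℝ)) x)) := by
  have h := tendsto_pi_nhds.1 (thickenedIndicator_tendsto_indicator_closure
    (fun n ↦ Nat.one_div_pos_of_nat (α := ℝ) (n := n))
    tendsto_one_div_add_atTop_nhds_zero_nat F) x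
  rw [hF.closure_eq] at h
  have hlim := (NNReal.continuous_coe.tendsto _).comp h
  have hval : ((F.indicator (fun _ ↦ (1 : ℝ≥0)) x : ℝ≥0) : ℝ) = F.indicator (fun _ ↦ (1 : ℝ)) x := by
    by_cases hx : x ∈ F <;> simp [hx]
  rwa [hval] at hlim

lemma tendsto_integral_thickenedIndicatorReal (P : Measure ℝ) [IsFiniteMeasure P] {F : Set ℝ}
    (hF : IsClosed F) :
    Tendsto (fun n ↦ ∫ x, thickenedIndicatorReal F n x ∂P) atTop (𝓝 (P.real F)) :=
  tendsto_integral_thickenedIndicator_of_isClosed P hF _ tendsto_one_div_add_atTop_nhds_zero_nat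

lemma ProbabilityMeasure.ext_of_integral_thickenedIndicatorReal {P Q : ProbabilityMeasure ℝ}
    (h : ∀ (a : ℚ) (n : ℕ), ∫ x, thickenedIndicatorReal (Set.Iic (a : ℝ)) n x ∂(P : Measure ℝ) =
      ∫ x, thickenedIndicatorReal (Set.Iic (a : ℝ)) n x ∂(Q : Measure ℝ)) : P = Q := by
  apply Subtype.ext
  change (P : Measure ℝ) = Q
  refine ext_of_generate_finite _
    (BorelSpace.measurable_eq.trans Real.borel_eq_generateFrom_Iic_rat) Real.isPiSystem_Iic_rat ?_ (by simp)
  intro s hs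
  obtain ⟨a, rfl⟩ : ∃ a : ℚ, s = Set.Iic (a : ℝ) := by simpa [eq_comm] using hs
  have h1 := tendsto_integral_thickenedIndicatorReal (P : Measure ℝ) (isClosed_Iic (a := (a : ℝ)))
  have h2 := tendsto_integral_thickenedIndicatorReal (Q : Measure ℝ) (isClosed_Iic (a := (a : ℝ)))
  simp only [h] at h1
  exact (measureReal_eq_measureReal_iff (by finiteness) (by finiteness)).1
    (tendsto_nhds_unique h1 h2)

/-- Eventual domination by the upper envelope of `S` over each Lipschitz function gives, along a
filter closed under countable intersections, eventual membership of finitely many integrals in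
the corresponding image of `S`. -/
lemma eventually_integral_mem_image {α ι : Type*} {l : Filter α} [CountableInterFilter l]
    (S : Set (ProbabilityMeasure ℝ)) (hS : IsCompact S)
    (hconv : ∀ P ∈ S, ∀ Q ∈ S, ∀ a b : ℝ≥0∞, a + b = 1 →
      ∃ R ∈ S, (R : Measure ℝ) = a • (P : Measure ℝ) + b • (Q : Measure ℝ))
    (P : α → ProbabilityMeasure ℝ)
    (hP : ∀ g : ℝ →ᵇ ℝ, (∃ C : ℝ≥0, LipschitzWith C g) → ∀ c : ℝ,
      (∀ Q ∈ S, ∫ y, g y ∂(Q : Measure ℝ) ≤ c) → ∀ᶠ x in l, ∫ y, g y ∂(P x : Measure ℝ) ≤ c)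
    [Fintype ι] (D : ι → ℝ →ᵇ ℝ) (hD : ∀ i, ∃ C : ℝ≥0, LipschitzWith C (D i)) :
    ∀ᶠ x in l, ∃ Q ∈ S, ∀ i, ∫ y, D i y ∂(Q : Measure ℝ) = ∫ y, D i y ∂(P x : Measure ℝ) := by
  classical
  let Φ : ProbabilityMeasure ℝ → ι → ℝ := fun Q i ↦ ∫ y, D i y ∂(Q : Measure ℝ)
  have hΦ : Continuous Φ := continuous_pi fun i ↦
    ProbabilityMeasure.continuous_integral_boundedContinuousFunction (D i)
  have hKclosed : IsClosed (Φ '' S) := (hS.image hΦ).isClosed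
  have hKconv : Convex ℝ (Φ '' S) := by
    rintro _ ⟨Q, hQ, rfl⟩ _ ⟨R, hR, rfl⟩ a b ha hb hab
    obtain ⟨T, hT, hTeq⟩ := hconv Q hQ R hR (ENNReal.ofReal a) (ENNReal.ofReal b)
      (by rw [← ENNReal.ofReal_add ha hb, hab, ENNReal.ofReal_one])
    refine ⟨T, hT, funext fun i ↦ ?_⟩
    have hi (μ : ProbabilityMeasure ℝ) : Integrable (D i) (μ : Measure ℝ) := (D i).integrable _
    simp only [Φ, hTeq, Pi.add_apply, Pi.smul_apply, smul_eq_mul]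
    rw [integral_add_measure ((hi Q).smul_measure (by finiteness))
      ((hi R).smul_measure (by finiteness)), integral_smul_measure, integral_smul_measure,
      ENNReal.toReal_ofReal ha, ENNReal.toReal_ofReal hb, smul_eq_mul, smul_eq_mul]
  have hfun (L : (ι → ℝ) →L[ℝ] ℝ) : ∃ g : ℝ →ᵇ ℝ, (∃ C : ℝ≥0, LipschitzWith C g) ∧
      ∀ Q : ProbabilityMeasure ℝ, ∫ y, g y ∂(Q : Measure ℝ) = L (Φ Q) := by
    refine ⟨∑ i, L (Pi.single i 1) • D i, ?_, fun Q ↦ ?_⟩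
    · refine Finset.sum_induction _ (fun g : ℝ →ᵇ ℝ ↦ ∃ C : ℝ≥0, LipschitzWith C g)
        ?_ ?_ ?_
      · rintro f g ⟨C, hC⟩ ⟨C', hC'⟩
        exact ⟨_, hC.add hC'⟩
      · exact ⟨0, LipschitzWith.const 0⟩
      · intro i _
        obtain ⟨C, hC⟩ := hD i
        exact ⟨_, (lipschitzWith_smul (L (Pi.single i 1))).comp hC⟩
    · have h : L (Φ Q) = ∑ i, L (Pi.single i 1) * Φ Q i := by
        conv_lhs => rw [pi_eq_sum_univ' (Φ Q)]
        simp [map_sum, mul_comm, Pi.single]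
      rw [h]
      simp only [BoundedContinuousFunction.coe_sum, Finset.sum_apply,
        BoundedContinuousFunction.coe_smul, smul_eq_mul]
      rw [integral_finsetSum _ fun i _ ↦ ((D i).integrable _).const_mul _]
      simp [Φ, integral_const_mul]
  let I : Set (((ι → ℝ) →L[ℝ] ℝ) × ℝ) := {p | ∀ w ∈ Φ '' S, p.1 w ≤ p.2}
  obtain ⟨T, hTI, hTc, hTU⟩ := TopologicalSpace.isOpen_biUnion_countable I
    (fun p ↦ {v : ι → ℝ | p.2 < p.1 v}) fun p _ ↦ isOpen_lt continuous_const p.1.continuous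
  have hev : ∀ᶠ x in l, ∀ p ∈ T, p.1 (Φ (P x)) ≤ p.2 := by
    refine (eventually_countable_ball hTc).2 fun p hp ↦ ?_
    obtain ⟨g, hg, hgΦ⟩ := hfun p.1
    simp only [← hgΦ]
    exact hP g hg p.2 fun Q hQ ↦ by rw [hgΦ]; exact hTI hp _ ⟨Q, hQ, rfl⟩
  filter_upwards [hev] with x hx
  by_contra hcon
  have hnot : Φ (P x) ∉ Φ '' S := by
    rintro ⟨Q, hQ, hQe⟩
    exact hcon ⟨Q, hQ, fun i ↦ congrFun hQe i⟩
  obtain ⟨L, u, hu, hu'⟩ := geometric_hahn_banach_closed_point hKconv hKclosed hnot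
  have hmem : Φ (P x) ∈ ⋃ p ∈ I, {v : ι → ℝ | p.2 < p.1 v} :=
    Set.mem_biUnion (x := (L, u)) (fun w hw ↦ (hu w hw).le) hu'
  rw [← hTU] at hmem
  obtain ⟨p, hpT, hp⟩ := Set.mem_iUnion₂.1 hmem
  exact absurd (hx p hpT) (not_le.2 hp)

/-- A family of probability measures that is eventually dominated by the upper envelope of a
convex compact set `S`, function by function, eventually lies in `S`. -/
lemma eventually_mem_of_eventually_integral_le {α : Type*} {l : Filter α} [CountableInterFilter l]
    (S : Set (ProbabilityMeasure ℝ)) (hS : IsCompact S)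
    (hconv : ∀ P ∈ S, ∀ Q ∈ S, ∀ a b : ℝ≥0∞, a + b = 1 →
      ∃ R ∈ S, (R : Measure ℝ) = a • (P : Measure ℝ) + b • (Q : Measure ℝ))
    (P : α → ProbabilityMeasure ℝ)
    (hP : ∀ g : ℝ →ᵇ ℝ, (∃ C : ℝ≥0, LipschitzWith C g) → ∀ c : ℝ,
      (∀ Q ∈ S, ∫ y, g y ∂(Q : Measure ℝ) ≤ c) → ∀ᶠ x in l, ∫ y, g y ∂(P x : Measure ℝ) ≤ c) :
    ∀ᶠ x in l, P x ∈ S := by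
  let D : ℚ × ℕ → ℝ →ᵇ ℝ := fun i ↦ thickenedIndicatorReal (Set.Iic (i.1 : ℝ)) i.2
  have hall : ∀ᶠ x in l, ∀ s : Finset (ℚ × ℕ), ∃ Q ∈ S, ∀ i : s,
      ∫ y, D i y ∂(Q : Measure ℝ) = ∫ y, D i y ∂(P x : Measure ℝ) :=
    eventually_countable_forall.2 fun s ↦ eventually_integral_mem_image S hS hconv P hP
      (fun i : s ↦ D i) fun i ↦ lipschitz_thickenedIndicatorReal _ _
  filter_upwards [hall] with x hx
  obtain ⟨Q, hQS, hQ⟩ := hS.inter_iInter_nonempty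
    (fun i ↦ {Q : ProbabilityMeasure ℝ |
      ∫ y, D i y ∂(Q : Measure ℝ) = ∫ y, D i y ∂(P x : Measure ℝ)})
    (fun i ↦ isClosed_eq
      (ProbabilityMeasure.continuous_integral_boundedContinuousFunction (D i)) continuous_const)
    (fun s ↦ by
      obtain ⟨Q, hQS, hQ⟩ := hx s
      exact ⟨Q, hQS, Set.mem_iInter₂.2 fun i hi ↦ hQ ⟨i, hi⟩⟩)
  rw [← ProbabilityMeasure.ext_of_integral_thickenedIndicatorReal
    fun a n ↦ Set.mem_iInter.1 hQ (a, n)]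
  exact hQS

/-- An integrable function whose integrals against all nonnegative bounded Lipschitz functions are
nonpositive is almost everywhere nonpositive. -/
lemma ae_nonpos_of_forall_integral_mul_nonpos (μ : Measure ℝ) [IsFiniteMeasure μ] {h : ℝ → ℝ}
    (hm : Measurable h) (hi : Integrable h μ)
    (hf : ∀ f : ℝ →ᵇ ℝ, (∃ C : ℝ≥0, LipschitzWith C f) → (∀ x, 0 ≤ f x) →
      ∫ x, f x * h x ∂μ ≤ 0) :
    ∀ᵐ x ∂μ, h x ≤ 0 := by
  have hclosed (F : Set ℝ) (hF : IsClosed F) : ∫ x in F, h x ∂μ ≤ 0 := by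
    rw [← integral_indicator hF.measurableSet]
    refine le_of_tendsto (f := fun n ↦ ∫ x, thickenedIndicatorReal F n x * h x ∂μ)
      (x := atTop) ?_ (Eventually.of_forall fun n ↦
        hf _ (lipschitz_thickenedIndicatorReal F n) (thickenedIndicatorReal_nonneg F n))
    refine tendsto_integral_of_dominated_convergence (fun x ↦ |h x|)
      (fun n ↦ ((thickenedIndicatorReal F n).continuous.measurable.mul hm).aestronglyMeasurable)
      hi.abs (fun n ↦ ae_of_all _ fun x ↦ ?_) (ae_of_all _ fun x ↦ ?_)
    · rw [norm_mul, Real.norm_of_nonneg (thickenedIndicatorReal_nonneg F n x), Real.norm_eq_abs]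
      exact mul_le_of_le_one_left (abs_nonneg _) (thickenedIndicatorReal_le_one F n x)
    · have hlim := (tendsto_thickenedIndicatorReal hF x).mul_const (h x)
      convert hlim using 2
      by_cases hx : x ∈ F <;> simp [hx]
  have hA : MeasurableSet {x | 0 < h x} := measurableSet_lt measurable_const hm
  by_contra hcon
  have hpos : 0 < μ {x | 0 < h x} := by
    refine pos_iff_ne_zero.2 fun h0 ↦ hcon ?_
    simpa [ae_iff] using h0
  obtain ⟨F, hFA, hF, hμF⟩ := hA.exists_lt_isClosed_of_ne_top (measure_ne_top μ _) hpos
  refine absurd (hclosed F hF) (not_le.2 ?_)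
  rw [setIntegral_pos_iff_support_of_nonneg_ae
    ((ae_restrict_iff' hF.measurableSet).2 (ae_of_all _ fun x hx ↦ (hFA hx).le)) hi.integrableOn]
  rwa [Set.inter_eq_right.2 fun x hx ↦ Function.mem_support.2 (hFA hx).ne']

lemma bddAbove_range_biSup_real {ι : Type*} {s : Set ι} {f : ι → ℝ} {M : ℝ} (hM : 0 ≤ M)
    (h : ∀ i ∈ s, f i ≤ M) : BddAbove (Set.range fun i ↦ ⨆ _ : i ∈ s, f i) :=
  ⟨M, by rintro _ ⟨i, rfl⟩; exact Real.iSup_le (h i) hM⟩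

lemma le_biSup_real {ι : Type*} {s : Set ι} {f : ι → ℝ} {M : ℝ} (hM : 0 ≤ M)
    (h : ∀ i ∈ s, f i ≤ M) {i : ι} (hi : i ∈ s) : f i ≤ ⨆ j ∈ s, f j := by
  refine le_ciSup_of_le (bddAbove_range_biSup_real hM h) i ?_
  have : Nonempty (i ∈ s) := ⟨hi⟩
  rw [ciSup_const]

lemma biSup_real_le {ι : Type*} {s : Set ι} {f : ι → ℝ} {M : ℝ} (hM : 0 ≤ M)
    (h : ∀ i ∈ s, f i ≤ M) : ⨆ i ∈ s, f i ≤ M :=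
  Real.iSup_le (fun i ↦ Real.iSup_le (h i) hM) hM

lemma abs_integral_le_of_abs_le {α : Type*} [MeasurableSpace α] {P : Measure α}
    [IsProbabilityMeasure P] {f : α → ℝ} {M : ℝ} (h : ∀ x, |f x| ≤ M) : |∫ x, f x ∂P| ≤ M := by
  simpa using norm_integral_le_of_norm_le_const (μ := P) (f := f) (ae_of_all _ h)

lemma integrable_of_continuous_of_abs_le {α : Type*} [MeasurableSpace α] [TopologicalSpace α]
    [OpensMeasurableSpace α] {P : Measure α} [IsFiniteMeasure P] {f : α → ℝ} {M : ℝ}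
    (hf : Continuous f) (h : ∀ x, |f x| ≤ M) : Integrable f P :=
  .of_bound hf.measurable.aestronglyMeasurable M (ae_of_all _ h)

/-- A composition of laws in `𝒫₀` is dominated by the two-step sublinear expectation. -/
lemma integral_compProd_le_biSup (𝒫₀ : Set (Measure ℝ))
    (hprob : ∀ Q ∈ 𝒫₀, IsProbabilityMeasure Q) {μ : Measure ℝ} (hμ : μ ∈ 𝒫₀)
    (κ : Kernel ℝ ℝ) [IsMarkovKernel κ] (hκ : ∀ x, κ x ∈ 𝒫₀)
    {φ : ℝ × ℝ → ℝ} (hφ : Continuous φ) {M : ℝ} (hM : ∀ p, |φ p| ≤ M) :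
    ∫ p, φ p ∂(μ.compProd κ) ≤ ⨆ P ∈ 𝒫₀, ∫ x, (⨆ Q ∈ 𝒫₀, ∫ y, φ (x, y) ∂Q) ∂P := by
  have := hprob μ hμ
  have hM0 : 0 ≤ M := (abs_nonneg _).trans (hM 0)
  have hin (x : ℝ) (Q) (hQ : Q ∈ 𝒫₀) : |∫ y, φ (x, y) ∂Q| ≤ M := by
    have := hprob Q hQ
    exact abs_integral_le_of_abs_le fun y ↦ hM (x, y)
  set S : ℝ → ℝ := fun x ↦ ⨆ Q ∈ 𝒫₀, ∫ y, φ (x, y) ∂Q with hS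
  have hle (x : ℝ) (Q) (hQ : Q ∈ 𝒫₀) : ∫ y, φ (x, y) ∂Q ≤ S x :=
    le_biSup_real hM0 (fun Q hQ ↦ (abs_le.1 (hin x Q hQ)).2) hQ
  have hSabs (x : ℝ) : |S x| ≤ M :=
    abs_le.2 ⟨(abs_le.1 (hin x μ hμ)).1.trans (hle x μ hμ),
      biSup_real_le hM0 fun Q hQ ↦ (abs_le.1 (hin x Q hQ)).2⟩
  have hSm : Measurable S := by
    refine LowerSemicontinuous.measurable (lowerSemicontinuous_ciSup
      (fun x ↦ bddAbove_range_biSup_real hM0 fun Q hQ ↦ (abs_le.1 (hin x Q hQ)).2) fun Q ↦ ?_)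
    refine Continuous.lowerSemicontinuous ?_
    by_cases hQ : Q ∈ 𝒫₀
    · have := hprob Q hQ
      have : Nonempty (Q ∈ 𝒫₀) := ⟨hQ⟩
      simp only [ciSup_const]
      refine continuous_of_dominated (bound := fun _ ↦ M) (fun x ↦ ?_)
        (fun x ↦ ae_of_all _ fun y ↦ hM (x, y)) (integrable_const M)
        (ae_of_all _ fun y ↦ by fun_prop)
      exact (hφ.comp (Continuous.prodMk_right x)).measurable.aestronglyMeasurable
    · have : IsEmpty (Q ∈ 𝒫₀) := ⟨hQ⟩
      simp only [Real.iSup_of_isEmpty]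
      exact continuous_const
  have hφi : Integrable φ (μ.compProd κ) := integrable_of_continuous_of_abs_le hφ hM
  rw [Measure.integral_compProd hφi]
  have hmean : Integrable (fun x ↦ ∫ y, φ (x, y) ∂(κ x)) μ :=
    .of_bound (StronglyMeasurable.integral_kernel_prod_right'
      hφ.stronglyMeasurable).aestronglyMeasurable M
      (ae_of_all _ fun x ↦ abs_integral_le_of_abs_le fun y ↦ hM (x, y))
  refine (integral_mono hmean (.of_bound hSm.aestronglyMeasurable M
    (ae_of_all _ hSabs)) fun x ↦ hle x _ (hκ x)).trans ?_
  refine le_biSup_real (f := fun P ↦ ∫ x, S x ∂P) hM0 (fun P hP ↦ ?_) hμ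
  have := hprob P hP
  exact (abs_le.1 (abs_integral_le_of_abs_le hSabs)).2

/-- `ν` is dominated on bounded Lipschitz functions by the two-step sublinear expectation of
`𝒫₀`. -/
def IsDominatedByEnvelope (𝒫₀ : Set (Measure ℝ)) (ν : Measure (ℝ × ℝ)) : Prop :=
  ∀ φ : ℝ × ℝ → ℝ, (∃ C : ℝ≥0, LipschitzWith C φ) → (∃ M : ℝ, ∀ p, |φ p| ≤ M) →
    ∫ p, φ p ∂ν ≤ ⨆ P ∈ 𝒫₀, ∫ x, (⨆ Q ∈ 𝒫₀, ∫ y, φ (x, y) ∂Q) ∂P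

lemma IsDominatedByEnvelope.integral_fst_le {𝒫₀ : Set (Measure ℝ)} {ν : Measure (ℝ × ℝ)}
    (hdom : IsDominatedByEnvelope 𝒫₀ ν) (h₀ : 𝒫₀.Nonempty)
    (hprob : ∀ Q ∈ 𝒫₀, IsProbabilityMeasure Q) [IsProbabilityMeasure ν]
    (g : ℝ →ᵇ ℝ) (hg : ∃ C : ℝ≥0, LipschitzWith C g) (c : ℝ)
    (hc : ∀ Q ∈ 𝒫₀, ∫ y, g y ∂Q ≤ c) : ∫ x, g x ∂ν.fst ≤ c := by
  obtain ⟨C, hC⟩ := hg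
  have hb (x : ℝ) : |g x| ≤ ‖g‖ := g.norm_coe_le_norm x
  have hgM (x : ℝ) : 0 ≤ g x + ‖g‖ := by linarith [(abs_le.1 (hb x)).1]
  have hcM : 0 ≤ c + ‖g‖ := by
    obtain ⟨Q, hQ⟩ := h₀
    have := hprob Q hQ
    linarith [hc Q hQ, (abs_le.1 (abs_integral_le_of_abs_le (P := Q) hb)).1]
  have key := hdom (fun p ↦ g p.1 + ‖g‖)
    ⟨_, (hC.comp LipschitzWith.prod_fst).add (LipschitzWith.const ‖g‖)⟩
    ⟨‖g‖ + ‖g‖, fun p ↦ (abs_of_nonneg (hgM p.1)).trans_le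
      (by linarith [(abs_le.1 (hb p.1)).2])⟩
  have hupper : ⨆ P ∈ 𝒫₀, ∫ x, (⨆ Q ∈ 𝒫₀, ∫ _, (g x + ‖g‖) ∂Q) ∂P ≤ c + ‖g‖ := by
    refine biSup_real_le hcM fun P hP ↦ ?_
    have := hprob P hP
    have hgi : Integrable g P := g.integrable P
    calc ∫ x, (⨆ Q ∈ 𝒫₀, ∫ _, (g x + ‖g‖) ∂Q) ∂P ≤ ∫ x, (g x + ‖g‖) ∂P := by
          refine integral_mono_of_nonneg (ae_of_all _ fun x ↦ ?_)
            (hgi.add (integrable_const _)) (ae_of_all _ fun x ↦ ?_)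
          · exact Real.iSup_nonneg fun Q ↦ Real.iSup_nonneg fun _ ↦
              integral_nonneg fun _ ↦ hgM x
          · refine biSup_real_le (hgM x) fun Q hQ ↦ ?_
            have := hprob Q hQ
            simp
      _ = ∫ x, g x ∂P + ‖g‖ := by rw [integral_add hgi (integrable_const _)]; simp
      _ ≤ c + ‖g‖ := by gcongr; exact hc P hP
  have hν : ∫ p, (g p.1 + ‖g‖) ∂ν = ∫ x, g x ∂ν.fst + ‖g‖ := by
    have hgi : Integrable (fun p : ℝ × ℝ ↦ g p.1) ν :=
      integrable_of_continuous_of_abs_le (g.continuous.comp continuous_fst) fun p ↦ hb p.1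
    rw [integral_add hgi (integrable_const _), Measure.fst,
      integral_map measurable_fst.aemeasurable g.continuous.measurable.aestronglyMeasurable]
    simp
  linarith [key.trans hupper]

lemma lipschitz_mul_of_bounded {f g : ℝ → ℝ} {A B : ℝ} {K L : ℝ≥0}
    (hf : LipschitzWith K f) (hg : LipschitzWith L g) (hA : ∀ x, |f x| ≤ A)
    (hB : ∀ x, |g x| ≤ B) :
    ∃ C : ℝ≥0, LipschitzWith C (fun p : ℝ × ℝ ↦ f p.1 * g p.2) := by
  refine ⟨_, LipschitzWith.of_dist_le' (K := A * L + B * K) fun p q ↦ ?_⟩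
  have hA0 := (abs_nonneg _).trans (hA 0)
  have hB0 := (abs_nonneg _).trans (hB 0)
  have h1 : |f p.1 - f q.1| ≤ K * dist p q :=
    (hf.dist_le_mul p.1 q.1).trans (by gcongr; exact le_max_left _ _)
  have h2 : |g p.2 - g q.2| ≤ L * dist p q :=
    (hg.dist_le_mul p.2 q.2).trans (by gcongr; exact le_max_right _ _)
  calc |f p.1 * g p.2 - f q.1 * g q.2|
      = |f p.1 * (g p.2 - g q.2) + g q.2 * (f p.1 - f q.1)| := by ring_nf
    _ ≤ |f p.1| * |g p.2 - g q.2| + |g q.2| * |f p.1 - f q.1| := by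
        rw [← abs_mul, ← abs_mul]; exact abs_add_le _ _
    _ ≤ A * (L * dist p q) + B * (K * dist p q) := by
        gcongr
        · exact hA _
        · exact hB _
    _ = (A * L + B * K) * dist p q := by ring

lemma IsDominatedByEnvelope.ae_integral_condKernel_le {𝒫₀ : Set (Measure ℝ)}
    {ν : Measure (ℝ × ℝ)} (hdom : IsDominatedByEnvelope 𝒫₀ ν)
    (hprob : ∀ Q ∈ 𝒫₀, IsProbabilityMeasure Q) [IsProbabilityMeasure ν]
    (g : ℝ →ᵇ ℝ) (hg : ∃ C : ℝ≥0, LipschitzWith C g) (c : ℝ)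
    (hc : ∀ Q ∈ 𝒫₀, ∫ y, g y ∂Q ≤ c) : ∀ᵐ x ∂ν.fst, ∫ y, g y ∂(ν.condKernel x) ≤ c := by
  obtain ⟨C, hC⟩ := hg
  have hb (x : ℝ) : |g x - c| ≤ ‖g‖ + |c| :=
    (abs_sub _ _).trans (by gcongr; exact g.norm_coe_le_norm x)
  have hsub (Q : Measure ℝ) [IsProbabilityMeasure Q] : ∫ y, (g y - c) ∂Q = ∫ y, g y ∂Q - c := by
    rw [integral_sub (g.integrable Q) (integrable_const _)]; simp
  have hm : Measurable fun x ↦ ∫ y, (g y - c) ∂(ν.condKernel x) :=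
    (StronglyMeasurable.integral_kernel
      (by exact (g.continuous.sub continuous_const).stronglyMeasurable)).measurable
  have hae : ∀ᵐ x ∂ν.fst, ∫ y, (g y - c) ∂(ν.condKernel x) ≤ 0 := by
    refine ae_nonpos_of_forall_integral_mul_nonpos ν.fst hm
      (.of_bound hm.aestronglyMeasurable _ (ae_of_all _ fun x ↦ abs_integral_le_of_abs_le hb))
      fun f hf hf0 ↦ ?_
    obtain ⟨K, hK⟩ := hf
    have hfb (x : ℝ) : |f x| ≤ ‖f‖ := f.norm_coe_le_norm x
    have hgl : LipschitzWith (C + 0) fun y ↦ g y - c := hC.sub (LipschitzWith.const c)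
    have hbd (p : ℝ × ℝ) : |f p.1 * (g p.2 - c)| ≤ ‖f‖ * (‖g‖ + |c|) := by
      rw [abs_mul]
      exact mul_le_mul (hfb _) (hb _) (abs_nonneg _) (norm_nonneg _)
    have hlip := lipschitz_mul_of_bounded hK hgl hfb hb
    have key := hdom (fun p ↦ f p.1 * (g p.2 - c)) hlip ⟨_, hbd⟩
    have hupper : ⨆ P ∈ 𝒫₀, ∫ x, (⨆ Q ∈ 𝒫₀, ∫ y, f x * (g y - c) ∂Q) ∂P ≤ 0 := by
      refine biSup_real_le le_rfl fun P _ ↦ integral_nonpos fun x ↦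
        biSup_real_le le_rfl fun Q hQ ↦ ?_
      have := hprob Q hQ
      rw [integral_const_mul, hsub]
      exact mul_nonpos_of_nonneg_of_nonpos (hf0 x) (sub_nonpos.2 (hc Q hQ))
    have hint : Integrable (fun p : ℝ × ℝ ↦ f p.1 * (g p.2 - c))
        (ν.fst.compProd ν.condKernel) := by
      obtain ⟨_, hl⟩ := hlip
      exact integrable_of_continuous_of_abs_le hl.continuous hbd
    have heq := Measure.integral_compProd hint
    rw [Measure.disintegrate] at heq
    simp only [integral_const_mul] at heq
    rw [← heq]
    exact key.trans hupper
  filter_upwards [hae] with x hx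
  rw [hsub] at hx
  linarith

/-- A kernel that almost surely takes values in `s` agrees almost everywhere with one that takes
values in `s` everywhere. -/
lemma Kernel.exists_ae_eq_forall_mem {α β : Type*} [MeasurableSpace α] [MeasurableSpace β]
    {μ : Measure α} {s : Set (Measure β)} (hs : ∀ Q ∈ s, IsProbabilityMeasure Q)
    (hne : s.Nonempty) (κ : Kernel α β) (hκ : ∀ᵐ x ∂μ, κ x ∈ s) :
    ∃ η : Kernel α β, IsMarkovKernel η ∧ (∀ x, η x ∈ s) ∧ κ =ᵐ[μ] η := by
  classical
  obtain ⟨Q, hQ⟩ := hne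
  obtain ⟨t, ht, htm, hts⟩ := hκ.exists_measurable_mem
  have hmem (x : α) : Kernel.piecewise htm κ (Kernel.const α Q) x ∈ s := by
    rw [Kernel.piecewise_apply]
    split_ifs with hx
    · exact hts x hx
    · rwa [Kernel.const_apply]
  refine ⟨Kernel.piecewise htm κ (Kernel.const α Q), ⟨fun x ↦ hs _ (hmem x)⟩, hmem, ?_⟩
  filter_upwards [ht] with x hx
  rw [Kernel.piecewise_apply, if_pos hx]

/-- representation theorem, two-step case: let `𝒫₀` be a nonempty convex
weakly compact set of Borel probability measures on `ℝ`, and for bounded Lipschitz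
`φ : ℝ² → ℝ` set `Ê[φ] = sup_{P∈𝒫₀} ∫ (sup_{Q∈𝒫₀} ∫ φ(x,y) dQ(y)) dP(x)`.
A Borel probability measure `ν` on `ℝ²` is dominated by `Ê` on all bounded Lipschitz
functions iff `ν = μ₁ ⊗ₘ κ` for some initial law `μ₁ ∈ 𝒫₀` and Markov kernel `κ` with
`κ(x,·) ∈ 𝒫₀` for all `x`. -/
theorem dominated_iff_kernel_decomposition
    (𝒫₀ : Set (Measure ℝ)) (h₀ : 𝒫₀.Nonempty)
    (hprob : ∀ Q ∈ 𝒫₀, IsProbabilityMeasure Q)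
    (hconv : ∀ μ ∈ 𝒫₀, ∀ ν ∈ 𝒫₀, ∀ a b : ℝ≥0∞, a + b = 1 → a • μ + b • ν ∈ 𝒫₀)
    (hcomp : IsCompact {Q : ProbabilityMeasure ℝ | (Q : Measure ℝ) ∈ 𝒫₀})
    (ν : Measure (ℝ × ℝ)) (hν : IsProbabilityMeasure ν) :
    (∀ φ : ℝ × ℝ → ℝ, (∃ C : ℝ≥0, LipschitzWith C φ) → (∃ M : ℝ, ∀ p, |φ p| ≤ M) →
      ∫ p, φ p ∂ν ≤ ⨆ P ∈ 𝒫₀, ∫ x, (⨆ Q ∈ 𝒫₀, ∫ y, φ (x, y) ∂Q) ∂P) ↔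
    ∃ μ₁ ∈ 𝒫₀, ∃ κ : Kernel ℝ ℝ, IsMarkovKernel κ ∧ (∀ x : ℝ, κ x ∈ 𝒫₀) ∧
      ν = μ₁.compProd κ := by
  constructor
  · intro hdom
    have hdom : IsDominatedByEnvelope 𝒫₀ ν := hdom
    have hS (P) (hP : P ∈ {Q : ProbabilityMeasure ℝ | (Q : Measure ℝ) ∈ 𝒫₀}) (Q)
        (hQ : Q ∈ {Q : ProbabilityMeasure ℝ | (Q : Measure ℝ) ∈ 𝒫₀}) (a b : ℝ≥0∞)
        (hab : a + b = 1) : ∃ R ∈ {Q : ProbabilityMeasure ℝ | (Q : Measure ℝ) ∈ 𝒫₀},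
          (R : Measure ℝ) = a • (P : Measure ℝ) + b • (Q : Measure ℝ) :=
      ⟨⟨_, hprob _ (hconv P hP Q hQ a b hab)⟩, hconv P hP Q hQ a b hab, rfl⟩
    have hfst : ν.fst ∈ 𝒫₀ := by
      have h := eventually_mem_of_eventually_integral_le (l := (⊤ : Filter Unit)) _ hcomp hS
        (fun _ ↦ ⟨ν.fst, inferInstance⟩) fun g hg c hc ↦ Eventually.of_forall fun _ ↦
          hdom.integral_fst_le h₀ hprob g hg c fun Q hQ ↦ hc ⟨Q, hprob Q hQ⟩ hQ
      exact (eventually_top.1 h) ()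
    have hcond : ∀ᵐ x ∂ν.fst, ν.condKernel x ∈ 𝒫₀ :=
      eventually_mem_of_eventually_integral_le _ hcomp hS
        (fun x ↦ ⟨ν.condKernel x, inferInstance⟩) fun g hg c hc ↦
          hdom.ae_integral_condKernel_le hprob g hg c fun Q hQ ↦ hc ⟨Q, hprob Q hQ⟩ hQ
    obtain ⟨κ, hκ, hκmem, hκeq⟩ := Kernel.exists_ae_eq_forall_mem hprob h₀ _ hcond
    exact ⟨ν.fst, hfst, κ, hκ, hκmem, by
      rw [← Measure.compProd_congr hκeq, Measure.disintegrate]⟩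
  · rintro ⟨μ₁, hμ₁, κ, hκ, hκmem, rfl⟩ φ ⟨C, hC⟩ ⟨M, hM⟩
    exact integral_compProd_le_biSup 𝒫₀ hprob hμ₁ κ hκmem hC.continuous hM


end
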